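/- arXiv:1507.04319 — 6 statements merged into one kernel-verified Lean document; each statement's English description precedes it below -/
import Mathlib

section
/- For all positive integers n and k with 1 ≤ k ≤ 2^n, the VC dimension of the class C_{n,k} is at most 2·k·log₂(e·2^{n+1}/k); in particular it is at most 2·log₂( binomial(2^{n+1}, k) ). -/
/-- The Boolean cube `{±1}^n`, as a subtype of `Fin n → ℝ`. -/
abbrev Cube (n : ℕ) := {x : Fin n → ℝ // ∀ j, x j = 1 ∨ x j = -1}

/-- The class `C_{n,k}` of `{±1}`-valued functions on the Boolean cube that are signs of
`k`-sparse polynomials (in the Fourier/monomial basis). -/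
def Cclass (n k : ℕ) : Set (Cube n → ℝ) :=
  {g | (∀ x, g x = 1 ∨ g x = -1) ∧
    ∃ (S : Fin k → Finset (Fin n)) (a : Fin k → ℝ),
      ∀ x : Cube n, 0 < g x * ∑ i, a i * ∏ j ∈ S i, x.1 j}

/-- A class of `{±1}`-valued functions shatters a finite set `T` if every `{±1}` labeling of
`T` is realized by a member of the class. -/
def Shatters {X : Type*} (C : Set (X → ℝ)) (T : Finset X) : Prop :=
  ∀ y : X → ℝ, (∀ t ∈ T, y t = 1 ∨ y t = -1) → ∃ g ∈ C, ∀ t ∈ T, g t = y t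

open Finset in
/-- Positivity sets of linear combinations of the functions `φ i`, `i ∈ U`, have VC dimension
at most `#U`. -/
theorem vcDim_le_card_of_pos_linearCombination {α ι : Type*} [DecidableEq α]
    (φ : ι → α → ℝ) (U : Finset ι) (𝒜 : Finset (Finset α))
    (h : ∀ P ∈ 𝒜, ∃ a : ι → ℝ, ∀ x, x ∈ P ↔ 0 < ∑ i ∈ U, a i * φ i x) :
    𝒜.vcDim ≤ #U := by
  refine Finset.sup_le fun s hs => ?_
  rw [mem_shatterer] at hs
  by_contra! hlt
  obtain ⟨c, hc, x₀, hx₀, hpos⟩ : ∃ c : α → ℝ, (∀ i ∈ U, ∑ x ∈ s, c x * φ i x = 0) ∧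
      ∃ x ∈ s, 0 < c x := by
    have hdep : ¬ LinearIndependent ℝ (fun (x : s) (i : U) => φ i x) := fun hli => by
      have := hli.fintype_card_le_finrank
      simp at this
      omega
    rw [Fintype.not_linearIndependent_iff] at hdep
    obtain ⟨g, hg, x₁, hx₁⟩ := hdep
    let c : α → ℝ := fun x => if hx : x ∈ s then g ⟨x, hx⟩ else 0
    have hc : ∀ i ∈ U, ∑ x ∈ s, c x * φ i x = 0 := by
      intro i hi
      have := congrFun hg ⟨i, hi⟩
      rw [← Finset.sum_coe_sort]
      simpa [c] using this
    have hcx₁ : c x₁ = g x₁ := by simp [c]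
    rcases lt_or_gt_of_ne hx₁ with hneg | hpos
    · refine ⟨fun x => -c x, fun i hi => ?_, x₁, x₁.2, ?_⟩
      · simp [hc i hi]
      · simpa [hcx₁] using hneg
    · exact ⟨c, hc, x₁, x₁.2, by simpa [hcx₁] using hpos⟩
  obtain ⟨P, hP, hsP⟩ := hs (filter_subset (fun x => 0 < c x) s)
  obtain ⟨a, ha⟩ := h P hP
  have hiff : ∀ x ∈ s, (0 < ∑ i ∈ U, a i * φ i x) ↔ 0 < c x := fun x hx => by
    rw [← ha]
    have : x ∈ s ∩ P ↔ x ∈ s.filter (fun x => 0 < c x) := by rw [hsP]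
    simpa [hx] using this
  have hzero : ∑ x ∈ s, c x * ∑ i ∈ U, a i * φ i x = 0 := by
    simp_rw [mul_sum]
    rw [sum_comm]
    refine sum_eq_zero fun i hi => ?_
    calc ∑ x ∈ s, c x * (a i * φ i x) = a i * ∑ x ∈ s, c x * φ i x := by
          rw [mul_sum]; exact sum_congr rfl fun x _ => by ring
      _ = 0 := by rw [hc i hi, mul_zero]
  refine hzero.not_gt (sum_pos' (fun x hx => ?_) ⟨x₀, hx₀, mul_pos hpos ((hiff x₀ hx₀).2 hpos)⟩)
  by_cases hx' : 0 < c x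
  · exact (mul_pos hx' ((hiff x hx).2 hx')).le
  · exact mul_nonneg_of_nonpos_of_nonpos (not_lt.1 hx') (not_lt.1 (mt (hiff x hx).1 hx'))

/-- A partial row sum of binomial coefficients is at most a single coefficient of the doubled row. -/
theorem Nat.sum_Iic_choose_le_choose_two_mul {N k : ℕ} (hk : k ≤ N) :
    ∑ i ∈ Finset.Iic k, N.choose i ≤ (2 * N).choose k := by
  rw [two_mul, Nat.add_choose_eq, Finset.Nat.sum_antidiagonal_eq_sum_range_succ_mk,
    ← Nat.range_succ_eq_Iic]
  exact Finset.sum_le_sum fun i _ => Nat.le_mul_of_pos_right _ (Nat.choose_pos (by omega))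

/-- The standard bound `m.choose k ≤ (e * m / k) ^ k`. -/
theorem Nat.choose_le_exp_mul_div_pow (m : ℕ) {k : ℕ} (hk : 0 < k) :
    (m.choose k : ℝ) ≤ (Real.exp 1 * m / k) ^ k := by
  have hk' : (0 : ℝ) < k := by exact_mod_cast hk
  have hexp := Real.pow_div_factorial_le_exp (k : ℝ) hk'.le k
  calc (m.choose k : ℝ) ≤ (m : ℝ) ^ k / k.factorial := Nat.choose_le_pow_div k m
    _ = (m / k : ℝ) ^ k * ((k : ℝ) ^ k / k.factorial) := by
        rw [div_pow]; field_simp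
    _ ≤ (m / k : ℝ) ^ k * Real.exp k := by gcongr
    _ = (Real.exp 1 * m / k) ^ k := by
        rw [mul_div_assoc, mul_pow, ← Real.exp_nat_mul, mul_one, mul_comm]

theorem Cube.card_finset_le {n : ℕ} (T : Finset (Cube n)) : T.card ≤ 2 ^ n := by
  classical
  let f : Cube n → Finset (Fin n) := fun x => Finset.univ.filter fun j => x.1 j = 1
  have hf : Function.Injective f := by
    intro x y hxy
    ext j
    have hj : x.1 j = 1 ↔ y.1 j = 1 := by
      have : j ∈ f x ↔ j ∈ f y := by rw [hxy]
      simpa [f] using this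
    rcases x.2 j with hx | hx <;> rcases y.2 j with hy | hy <;> simp_all
  calc T.card ≤ (Finset.univ : Finset (Finset (Fin n))).card :=
        Finset.card_le_card_of_injOn f (fun _ _ => Finset.mem_univ _) hf.injOn
    _ = 2 ^ n := by simp

/-- Members of `Cclass n k` are represented on an index family of exactly `k` monomials. -/
theorem Cclass.exists_powersetCard {n k : ℕ} (hk : k ≤ 2 ^ n) {g : Cube n → ℝ}
    (hg : g ∈ Cclass n k) :
    ∃ U ∈ Finset.powersetCard k (Finset.univ : Finset (Finset (Fin n))),
      ∃ b : Finset (Fin n) → ℝ, ∀ x : Cube n, 0 < g x * ∑ S ∈ U, b S * ∏ j ∈ S, x.1 j := by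
  classical
  obtain ⟨-, S, a, ha⟩ := hg
  obtain ⟨U, hSU, -, hU⟩ := Finset.exists_subsuperset_card_eq
    (Finset.subset_univ (Finset.univ.image S))
    (Finset.card_image_le.trans_eq (Finset.card_fin k)) (by simpa using hk)
  refine ⟨U, by simp [Finset.mem_powersetCard, hU],
    fun V => ∑ i ∈ Finset.univ.filter (fun i => S i = V), a i, fun x => ?_⟩
  convert ha x using 2
  rw [← Finset.sum_fiberwise_of_maps_to (s := Finset.univ) (t := U) (g := S)
    fun i _ => hSU (Finset.mem_image_of_mem S (Finset.mem_univ i))]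
  refine Finset.sum_congr rfl fun V _ => ?_
  rw [Finset.sum_mul]
  exact Finset.sum_congr rfl fun i hi => by rw [(Finset.mem_filter.1 hi).2]

theorem Cclass.two_pow_card_le_of_shatters {n k : ℕ} (hk : k ≤ 2 ^ n) {T : Finset (Cube n)}
    (hT : Shatters (Cclass n k) T) :
    2 ^ T.card ≤ (2 ^ n).choose k * ∑ i ∈ Finset.Iic k, T.card.choose i := by
  classical
  let A : Finset (Finset (Fin n)) → Finset (Finset T) := fun U => Finset.univ.filter fun P =>
    ∃ a : Finset (Fin n) → ℝ, ∀ x : T, x ∈ P ↔ 0 < ∑ S ∈ U, a S * ∏ j ∈ S, x.1.1 j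
  have hcover : (Finset.univ : Finset (Finset T)) ⊆
      (Finset.powersetCard k (Finset.univ : Finset (Finset (Fin n)))).biUnion A := by
    intro P _
    obtain ⟨g, hg, hgP⟩ := hT (fun x => if ∃ hx : x ∈ T, ⟨x, hx⟩ ∈ P then 1 else -1)
      fun t _ => ite_eq_or_eq _ _ _
    obtain ⟨U, hU, b, hb⟩ := Cclass.exists_powersetCard hk hg
    refine Finset.mem_biUnion.2 ⟨U, hU, Finset.mem_filter.2 ⟨Finset.mem_univ _, b, fun x => ?_⟩⟩
    have hx := hb x.1
    rw [hgP x.1 x.2] at hx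
    by_cases hxP : x ∈ P
    · simpa [hxP] using hx
    · simpa [hxP] using (show _ ≤ (0 : ℝ) by simp [hxP] at hx; exact hx.le)
  have hA : ∀ U ∈ Finset.powersetCard k (Finset.univ : Finset (Finset (Fin n))),
      (A U).card ≤ ∑ i ∈ Finset.Iic k, T.card.choose i := by
    intro U hU
    have hdim : (A U).vcDim ≤ k := (Finset.mem_powersetCard.1 hU).2 ▸
      vcDim_le_card_of_pos_linearCombination (fun S (x : T) => ∏ j ∈ S, x.1.1 j) U (A U)
        fun P hP => (Finset.mem_filter.1 hP).2
    calc (A U).card ≤ (A U).shatterer.card := Finset.card_le_card_shatterer _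
      _ ≤ ∑ i ∈ Finset.Iic (A U).vcDim, (Fintype.card T).choose i :=
          Finset.card_shatterer_le_sum_vcDim
      _ ≤ ∑ i ∈ Finset.Iic k, T.card.choose i := by
          rw [Fintype.card_coe]
          exact Finset.sum_le_sum_of_subset (Finset.Iic_subset_Iic.2 hdim)
  simpa using (Finset.card_le_card hcover).trans (Finset.card_biUnion_le_card_mul _ _ _ hA)

/-- The VC dimension of `C_{n,k}` is at most `2·k·log₂(e·2^(n+1)/k)`; in particular it is at
most `2·log₂ (binomial (2^(n+1)) k)`. -/
theorem vcDim_Cclass_upper (n k : ℕ) (hn : 0 < n) (hk : 1 ≤ k) (hk' : k ≤ 2 ^ n)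
    (T : Finset (Cube n)) (hT : Shatters (Cclass n k) T) :
    (T.card : ℝ) ≤ 2 * k * Real.logb 2 (Real.exp 1 * 2 ^ (n + 1) / k) ∧
    (T.card : ℝ) ≤ 2 * Real.logb 2 (Nat.choose (2 ^ (n + 1)) k) := by
  have hcount : 2 ^ T.card ≤ (2 ^ (n + 1)).choose k ^ 2 := by
    have hsum : ∑ i ∈ Finset.Iic k, T.card.choose i ≤ (2 ^ (n + 1)).choose k := by
      rw [pow_succ']
      exact (Finset.sum_le_sum fun i _ => Nat.choose_le_choose i (Cube.card_finset_le T)).trans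
        (Nat.sum_Iic_choose_le_choose_two_mul hk')
    rw [sq]
    exact (Cclass.two_pow_card_le_of_shatters hk' hT).trans (Nat.mul_le_mul
      (Nat.choose_le_choose k (Nat.pow_le_pow_right two_pos n.le_succ)) hsum)
  have hchoose : (0 : ℝ) < ((2 ^ (n + 1)).choose k : ℕ) := by
    exact_mod_cast Nat.choose_pos (hk'.trans (Nat.pow_le_pow_right two_pos n.le_succ))
  have hbinom : (T.card : ℝ) ≤ 2 * Real.logb 2 (Nat.choose (2 ^ (n + 1)) k) := by
    have hlog := Real.logb_le_logb_of_le one_lt_two (by positivity)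
      (show (2 : ℝ) ^ T.card ≤ ((2 ^ (n + 1)).choose k : ℝ) ^ 2 by exact_mod_cast hcount)
    rw [Real.logb_pow, Real.logb_pow, Real.logb_self_eq_one one_lt_two] at hlog
    simpa using hlog
  refine ⟨hbinom.trans ?_, hbinom⟩
  have hle := Real.logb_le_logb_of_le one_lt_two hchoose
    (Nat.choose_le_exp_mul_div_pow (2 ^ (n + 1)) hk)
  rw [Real.logb_pow] at hle
  push_cast at hle
  linarith
end

section
/- For all positive integers n and k with 1 ≤ k ≤ 2^n, there exists a subset of {−1,1}^n of cardinality k that is shattered by the class C_{n,k}; consequently the VC dimension of C_{n,k} is at least k. -/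
/-- The Boolean cube is parametrized by Boolean vectors. -/
noncomputable def cubeEquiv (n : ℕ) : (Fin n → Bool) ≃ Cube n :=
  Equiv.ofBijective
    (fun b => ⟨fun j => if b j then 1 else -1, fun j => by dsimp only; split_ifs <;> simp⟩) <| by
    constructor
    · intro b c h
      funext j
      have hj := congrFun (congrArg Subtype.val h) j
      cases hb : b j <;> cases hc : c j <;> simp [hb, hc] at hj ⊢ <;> norm_num at hj
    · rintro ⟨x, hx⟩
      refine ⟨fun j => decide (x j = 1), Subtype.ext (funext fun j => ?_)⟩
      rcases hx j with h | h <;> norm_num [h]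

instance cube_finite (n : ℕ) : Finite (Cube n) := Finite.of_equiv _ (cubeEquiv n)

theorem exists_finset_cube_card_eq {n k : ℕ} (hk : k ≤ 2 ^ n) :
    ∃ T : Finset (Cube n), T.card = k := by
  obtain ⟨s, -, hs⟩ := Finset.exists_subset_card_eq
    (s := (Finset.univ : Finset (Fin n → Bool))) (n := k) (by simpa using hk)
  exact ⟨s.map (cubeEquiv n).toEmbedding, by simpa using hs⟩

theorem Cube.prod_eq_one_or_neg_one {n : ℕ} (x : Cube n) (s : Finset (Fin n)) :
    ∏ j ∈ s, x.1 j = 1 ∨ ∏ j ∈ s, x.1 j = -1 := by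
  induction s using Finset.induction_on with
  | empty => simp
  | insert j s hj ih =>
    rw [Finset.prod_insert hj]
    rcases ih with h | h <;> rcases x.2 j with h' | h' <;> simp [h, h']

theorem Cube.prod_one_add_mul_eq_zero {n : ℕ} {t x : Cube n} (h : t ≠ x) :
    ∏ j, (1 + t.1 j * x.1 j) = 0 := by
  obtain ⟨j, hj⟩ := Function.ne_iff.mp (Subtype.coe_ne_coe.mpr h)
  refine Finset.prod_eq_zero (Finset.mem_univ j) ?_
  rcases t.2 j with h1 | h1 <;> rcases x.2 j with h2 | h2 <;> simp_all

theorem Cube.prod_one_add_mul_self {n : ℕ} (t : Cube n) :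
    ∏ j, (1 + t.1 j * t.1 j) = 2 ^ n := by
  have (j : Fin n) : 1 + t.1 j * t.1 j = 2 := by
    rcases t.2 j with h | h <;> norm_num [h]
  simp [this]

/-- The monomials span all real functions on a finite set of points of the cube. -/
theorem span_monomials_eq_top {n : ℕ} (T : Finset (Cube n)) :
    Submodule.span ℝ
      (Set.range fun (s : Finset (Fin n)) (t : T) => ∏ j ∈ s, t.1.1 j) = ⊤ := by
  classical
  rw [eq_top_iff, ← (Pi.basisFun ℝ T).span_eq, Submodule.span_le]
  rintro _ ⟨t, rfl⟩
  have key : Pi.basisFun ℝ T t = ∑ s : Finset (Fin n),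
      ((2 ^ n)⁻¹ * ∏ j ∈ s, t.1.1 j) • fun x : T => ∏ j ∈ s, x.1.1 j := by
    funext x
    have expand : ∑ s : Finset (Fin n), (∏ j ∈ s, t.1.1 j) * ∏ j ∈ s, x.1.1 j
        = ∏ j, (1 + t.1.1 j * x.1.1 j) := by
      simp [Finset.prod_one_add, Finset.prod_mul_distrib]
    simp only [Finset.sum_apply, Pi.smul_apply, smul_eq_mul, mul_assoc, ← Finset.mul_sum, expand]
    by_cases h : t = x
    · subst h
      simp [Cube.prod_one_add_mul_self]
    · rw [Cube.prod_one_add_mul_eq_zero fun h' => h (Subtype.ext h')]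
      simp [Ne.symm h]
  rw [key]
  exact Submodule.sum_mem _ fun s _ =>
    Submodule.smul_mem _ _ (Submodule.subset_span ⟨s, rfl⟩)

/-- On any `T` in the cube, `#T` monomials suffice to interpolate all real functions. -/
theorem exists_monomials_interpolating {n k : ℕ} (T : Finset (Cube n)) (hT : T.card = k) :
    ∃ S : Fin k → Finset (Fin n), ∀ y : Cube n → ℝ, ∃ a : Fin k → ℝ,
      ∀ t ∈ T, ∑ i, a i * ∏ j ∈ S i, t.1 j = y t := by
  obtain ⟨f, hf, hspan, -⟩ := Submodule.exists_fun_fin_finrank_span_eq ℝ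
    (Set.range fun (s : Finset (Fin n)) (t : T) => ∏ j ∈ s, t.1.1 j)
  have hrank : Module.finrank ℝ (Submodule.span ℝ
      (Set.range fun (s : Finset (Fin n)) (t : T) => ∏ j ∈ s, t.1.1 j)) = k := by
    rw [span_monomials_eq_top, finrank_top]
    simpa using hT
  replace hspan := hspan.trans (span_monomials_eq_top T)
  choose S hS using hf
  subst hrank
  refine ⟨S, fun y => ?_⟩
  have hy : (fun t : T => y t) ∈ Submodule.span ℝ (Set.range f) := hspan ▸ Submodule.mem_top
  obtain ⟨a, ha⟩ := (Submodule.mem_span_range_iff_exists_fun ℝ).mp hy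
  refine ⟨a, fun t ht => ?_⟩
  have := congrFun ha ⟨t, ht⟩
  simpa [← hS] using this

/-- A perturbation by a small multiple of `u` makes a function nowhere zero. -/
theorem exists_small_perturbation_ne_zero {X : Type*} [Finite X] (p u : X → ℝ)
    (hu : ∀ x, u x ≠ 0) : ∃ ε ∈ Set.Ioo (0 : ℝ) 1, ∀ x, p x + ε * u x ≠ 0 := by
  obtain ⟨ε, hε, hne⟩ := (Set.Ioo_infinite (zero_lt_one (α := ℝ))).exists_notMem_finite
    (Set.finite_range fun x => -p x / u x)
  refine ⟨ε, hε, fun x hx => hne ⟨x, ?_⟩⟩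
  rw [div_eq_iff (hu x)]
  linarith

/-- For `1 ≤ k ≤ 2^n` there is a `k`-element subset of the cube shattered by `C_{n,k}`;
hence the VC dimension of `C_{n,k}` is at least `k`. -/
theorem vcDim_Cclass_ge_k (n k : ℕ) (hn : 0 < n) (hk : 1 ≤ k) (hk' : k ≤ 2 ^ n) :
    ∃ T : Finset (Cube n), T.card = k ∧ Shatters (Cclass n k) T := by
  obtain ⟨T, hT⟩ := exists_finset_cube_card_eq hk'
  obtain ⟨S, hS⟩ := exists_monomials_interpolating T hT
  refine ⟨T, hT, fun y hy => ?_⟩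
  obtain ⟨a, ha⟩ := hS y
  let i₀ : Fin k := ⟨0, hk⟩
  have hu := fun x : Cube n => x.prod_eq_one_or_neg_one (S i₀)
  obtain ⟨ε, ⟨hε₀, hε₁⟩, hne⟩ := exists_small_perturbation_ne_zero
    (fun x : Cube n => ∑ i, a i * ∏ j ∈ S i, x.1 j) (fun x => ∏ j ∈ S i₀, x.1 j)
    (fun x => by rcases hu x with h | h <;> norm_num [h])
  have hsum (x : Cube n) : ∑ i, (a i + if i = i₀ then ε else 0) * ∏ j ∈ S i, x.1 j
      = ∑ i, a i * ∏ j ∈ S i, x.1 j + ε * ∏ j ∈ S i₀, x.1 j := by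
    simp [add_mul, Finset.sum_add_distrib]
  let q : Cube n → ℝ := fun x => ∑ i, a i * ∏ j ∈ S i, x.1 j + ε * ∏ j ∈ S i₀, x.1 j
  refine ⟨fun x => if 0 < q x then 1 else -1,
    ⟨fun x => by dsimp only; split_ifs <;> simp,
      S, fun i => a i + (if i = i₀ then ε else 0), fun x => ?_⟩, fun t ht => ?_⟩
  · rw [hsum]
    change 0 < (if 0 < q x then 1 else -1) * q x
    split_ifs with h
    · simpa using h
    · have := lt_of_le_of_ne (not_lt.mp h) (hne x)
      linarith
  · have hq : q t = y t + ε * ∏ j ∈ S i₀, t.1 j := by rw [← ha t ht]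
    dsimp only
    rw [hq]
    rcases hy t ht with h | h <;> rcases hu t with h' | h' <;> rw [h, h'] <;>
      split_ifs <;> linarith
end

section
/- Let n = n₁ + n₂ and let z : (Fin n → ZMod 2) → ℝ be a function whose support has cardinality at most k. Then the real matrix M, indexed by v' ∈ (Fin n₁ → ZMod 2) and v'' ∈ (Fin n₂ → ZMod 2) and defined by M(v', v'') = ∑_{u} z(u) · (−1)^{∑_j u_j · (v',v'')_j} (exponents via 0/1 lifts, (v',v'') denoting the concatenated vector in Fin n → ZMod 2), has rank at most k. Consequently, if M has no zero entries, then the {−1,1}-matrix S with S(v',v'') = 1 when M(v',v'') > 0 and S(v',v'') = −1 when M(v',v'') < 0 has sign rank at most k. -/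
/-- The sign rank of a `{±1}`-matrix `S`: the minimum rank of a real matrix `M` with
`M i j * S i j > 0` for all entries. -/
noncomputable def signRank {α β : Type*} [Fintype α] [Fintype β] (S : Matrix α β ℝ) : ℕ :=
  sInf {r : ℕ | ∃ M : Matrix α β ℝ, (∀ i j, 0 < M i j * S i j) ∧ M.rank = r}

/-- A product `A * diagonal z * B` has rank at most the size of the support of `z`. -/
theorem Matrix.rank_mul_diagonal_mul_le {α β ι : Type*} [Fintype α] [Fintype β] [Fintype ι]
    [DecidableEq ι] (A : Matrix α ι ℝ) (z : ι → ℝ) (B : Matrix ι β ℝ) :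
    (A * Matrix.diagonal z * B).rank ≤ (Function.support z).ncard := by
  classical
  calc (A * Matrix.diagonal z * B).rank
      ≤ (A * Matrix.diagonal z).rank := Matrix.rank_mul_le_left _ _
    _ ≤ (Matrix.diagonal z).rank := Matrix.rank_mul_le_right _ _
    _ = (Function.support z).ncard := by
      rw [Matrix.rank_diagonal, ← Nat.card_coe_set_eq, ← Nat.card_eq_fintype_card]
      rfl

/-- The sign rank of the sign matrix of a nowhere-vanishing `M` is at most the rank of `M`. -/
theorem signRank_sign_le_rank {α β : Type*} [Fintype α] [Fintype β] (M : Matrix α β ℝ)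
    (hM : ∀ i j, M i j ≠ 0) :
    signRank (Matrix.of fun i j => if 0 < M i j then (1 : ℝ) else -1) ≤ M.rank := by
  refine Nat.sInf_le ⟨M, fun i j => ?_, rfl⟩
  rw [Matrix.of_apply]
  split_ifs with h
  · simpa using h
  · simpa using lt_of_le_of_ne (not_lt.mp h) (hM i j)

/-- If `z` is supported on at most `k` points, then the matrix
`M (v', v'') = ∑ u, z u * (-1)^(∑ j, u j * (v', v'') j)` (Walsh kernel with concatenated
argument) has rank at most `k`; consequently, if `M` has no zero entries then its entrywise
sign matrix has sign rank at most `k`. -/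
theorem walsh_sparse_rank_le (n₁ n₂ k : ℕ) (z : (Fin (n₁ + n₂) → ZMod 2) → ℝ)
    (hz : (Function.support z).ncard ≤ k)
    (M : Matrix (Fin n₁ → ZMod 2) (Fin n₂ → ZMod 2) ℝ)
    (hM : ∀ v' v'', M v' v'' =
      ∑ u : Fin (n₁ + n₂) → ZMod 2,
        z u * (-1 : ℝ) ^ ∑ j, (u j).val * ((Fin.append v' v'') j).val) :
    M.rank ≤ k ∧
    ((∀ v' v'', M v' v'' ≠ 0) →
      signRank (Matrix.of fun v' v'' => if 0 < M v' v'' then (1 : ℝ) else -1) ≤ k) := by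
  have hfactor : M =
      (Matrix.of fun (v' : Fin n₁ → ZMod 2) (u : Fin (n₁ + n₂) → ZMod 2) =>
          (-1 : ℝ) ^ ∑ j, (u (Fin.castAdd n₂ j)).val * (v' j).val) *
        Matrix.diagonal z *
        (Matrix.of fun (u : Fin (n₁ + n₂) → ZMod 2) (v'' : Fin n₂ → ZMod 2) =>
          (-1 : ℝ) ^ ∑ j, (u (Fin.natAdd n₁ j)).val * (v'' j).val) := by
    ext v' v''
    rw [hM, Matrix.mul_apply]
    refine Finset.sum_congr rfl fun u _ => ?_
    rw [Matrix.mul_diagonal, Matrix.of_apply, Matrix.of_apply, Fin.sum_univ_add, pow_add]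
    simp only [Fin.append_left, Fin.append_right]
    ring
  have hrank : M.rank ≤ k := by
    rw [hfactor]
    exact (Matrix.rank_mul_diagonal_mul_le _ z _).trans hz
  exact ⟨hrank, fun hne => (signRank_sign_le_rank M hne).trans hrank⟩
end

section
/- Let n and k be positive integers with 32·(k+1) ≤ 2^{⌊n/2⌋}. Then there exists a subset T of {−1,1}^n with |T| = (32·(k+1))² that the class C_{n,k} fails to shatter. -/
/-- The polynomial `∑ a i * v x i` has the sign pattern given by `u`: it is positive on `u` and
negative off `u`. -/
def SignPattern {α : Type*} {k : ℕ} (v : α → Fin k → ℝ) (u : Finset α) : Prop :=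
  ∃ a : Fin k → ℝ, ∀ x, (x ∈ u → 0 < ∑ i, a i * v x i) ∧ (x ∉ u → ∑ i, a i * v x i < 0)

/-- Sign patterns of a `k`-dimensional space of functions shatter only sets of size at most `k`. -/
theorem card_le_of_shatters_signPattern {α : Type*} [DecidableEq α] {k : ℕ}
    (v : α → Fin k → ℝ) (𝒜 : Finset (Finset α)) (h𝒜 : ∀ u ∈ 𝒜, SignPattern v u)
    {s : Finset α} (hs : 𝒜.Shatters s) : s.card ≤ k := by
  by_contra! hlt
  have hdep : ¬ LinearIndependent ℝ (fun x : s => v x) := fun hli => by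
    have := hli.fintype_card_le_finrank
    simp at this
    omega
  obtain ⟨c, hc, w, hw⟩ := Fintype.not_linearIndependent_iff.1 hdep
  obtain ⟨u, hu, hsu⟩ := hs (t := (Finset.univ.filter fun x : s => 0 < c x).map
    (Function.Embedding.subtype _)) (by intro x; simp; tauto)
  have hmem : ∀ x : s, x.1 ∈ u ↔ 0 < c x := fun x => by
    have := Finset.ext_iff.1 hsu x.1
    simpa using this
  obtain ⟨a, ha⟩ := h𝒜 u hu
  have hterm : ∀ x : s, c x ≠ 0 → 0 < c x * ∑ i, a i * v x i := fun x hx => by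
    rcases lt_or_gt_of_ne hx with hneg | hpos
    · exact mul_pos_of_neg_of_neg hneg ((ha x).2 fun hxu => by linarith [(hmem x).1 hxu])
    · exact mul_pos hpos ((ha x).1 ((hmem x).2 hpos))
  have hpos : 0 < ∑ x : s, c x * ∑ i, a i * v x i := by
    refine Finset.sum_pos' (fun x _ => ?_) ⟨w, Finset.mem_univ _, hterm w hw⟩
    by_cases hx : c x = 0
    · simp [hx]
    · exact (hterm x hx).le
  have hzero : ∑ x : s, c x * ∑ i, a i * v x i = ∑ i, a i * (∑ x : s, c x • v x) i := by
    simp only [Finset.sum_apply, Pi.smul_apply, smul_eq_mul, Finset.mul_sum]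
    rw [Finset.sum_comm]
    exact Finset.sum_congr rfl fun _ _ => Finset.sum_congr rfl fun _ _ => by ring
  rw [hzero, hc] at hpos
  simp at hpos

theorem sum_choose_le_succ_pow (m k : ℕ) : ∑ i ∈ Finset.Iic k, m.choose i ≤ (m + 1) ^ k := by
  rw [add_pow, ← Nat.range_succ_eq_Iic]
  refine Finset.sum_le_sum fun i hi => ?_
  have hik : 0 < k.choose i := Nat.choose_pos (by simpa [Nat.lt_succ_iff] using hi)
  simpa using (Nat.choose_le_pow m i).trans (Nat.le_mul_of_pos_right _ hik)

/-- A `k`-dimensional space of functions on `m` points has at most `(m + 1) ^ k` sign patterns. -/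
theorem card_signPattern_le {α : Type*} [DecidableEq α] [Fintype α] {k : ℕ}
    (v : α → Fin k → ℝ) (𝒜 : Finset (Finset α)) (h𝒜 : ∀ u ∈ 𝒜, SignPattern v u) :
    𝒜.card ≤ (Fintype.card α + 1) ^ k := by
  have hvc : 𝒜.vcDim ≤ k := Finset.sup_le fun s hs =>
    card_le_of_shatters_signPattern v 𝒜 h𝒜 (Finset.mem_shatterer.1 hs)
  calc 𝒜.card ≤ 𝒜.shatterer.card := Finset.card_le_card_shatterer 𝒜
    _ ≤ ∑ i ∈ Finset.Iic 𝒜.vcDim, (Fintype.card α).choose i := Finset.card_shatterer_le_sum_vcDim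
    _ ≤ ∑ i ∈ Finset.Iic k, (Fintype.card α).choose i :=
      Finset.sum_le_sum_of_subset (Finset.Iic_subset_Iic.2 hvc)
    _ ≤ (Fintype.card α + 1) ^ k := sum_choose_le_succ_pow _ _

/-- The point of the cube whose coordinates equal to `-1` are those in `A`. -/
noncomputable def cubePoint {n : ℕ} (A : Finset (Fin n)) : Cube n :=
  ⟨fun j => if j ∈ A then -1 else 1, fun j => by by_cases hj : j ∈ A <;> simp [hj]⟩

theorem cubePoint_injective {n : ℕ} : Function.Injective (cubePoint (n := n)) := fun A B hAB => by
  ext j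
  have hj : (cubePoint A).1 j = (cubePoint B).1 j := by rw [hAB]
  by_cases hA : j ∈ A <;> by_cases hB : j ∈ B <;> simp [cubePoint, hA, hB] at hj ⊢ <;>
    norm_num at hj

/-- If `C_{n,k}` shatters a set of points that are constantly `1` outside the coordinates in `D`,
then the set satisfies a bound depending on `D.card` rather than `n`. -/
theorem two_pow_card_le_of_shatters {n k : ℕ} (D : Finset (Fin n)) (T : Finset (Cube n))
    (hT : ∀ x ∈ T, ∀ j ∉ D, x.1 j = 1) (hsh : Shatters (Cclass n k) T) :
    2 ^ T.card ≤ (2 ^ D.card) ^ k * (T.card + 1) ^ k := by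
  classical
  let v (S : Fin k → Finset (Fin n)) (x : T) (i : Fin k) : ℝ := ∏ j ∈ S i, x.1.1 j
  let P := Fintype.piFinset fun _ : Fin k => D.powerset
  have hcover : (Finset.univ : Finset (Finset T)) ⊆
      P.biUnion fun S => Finset.univ.filter (SignPattern (v S)) := by
    intro u _
    obtain ⟨g, ⟨-, S, a, hSa⟩, hgu⟩ := hsh
      (fun x => if x ∈ u.map (Function.Embedding.subtype _) then 1 else -1)
      (fun t _ => by split_ifs <;> simp)
    refine Finset.mem_biUnion.2 ⟨fun i => S i ∩ D, ?_, ?_⟩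
    · simp [P]
    refine Finset.mem_filter.2 ⟨Finset.mem_univ _, a, fun x => ?_⟩
    have hv : ∀ i, v (fun i => S i ∩ D) x i = ∏ j ∈ S i, x.1.1 j := fun i =>
      Finset.prod_subset Finset.inter_subset_left fun j hj hjD =>
        hT x x.2 j fun hD => hjD (Finset.mem_inter.2 ⟨hj, hD⟩)
    have hx := hSa x.1
    rw [hgu x.1 x.2] at hx
    simp only [hv]
    constructor <;> intro hxu <;> simpa [hxu] using hx
  calc 2 ^ T.card = (Finset.univ : Finset (Finset T)).card := by simp
    _ ≤ _ := Finset.card_le_card hcover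
    _ ≤ P.card * (T.card + 1) ^ k := Finset.card_biUnion_le_card_mul _ _ _ fun S _ => by
      simpa using card_signPattern_le (v S) (Finset.univ.filter (SignPattern (v S))) (by simp)
    _ = (2 ^ D.card) ^ k * (T.card + 1) ^ k := by simp [P, Fintype.card_piFinset]

/-- If `32·(k+1) ≤ 2^⌊n/2⌋`, then there is a subset of the Boolean cube of cardinality
`(32·(k+1))²` that the class `C_{n,k}` fails to shatter. -/
theorem Cclass_fails_to_shatter (n k : ℕ) (hn : 0 < n) (hk : 0 < k)
    (h : 32 * (k + 1) ≤ 2 ^ (n / 2)) :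
    ∃ T : Finset (Cube n), T.card = (32 * (k + 1)) ^ 2 ∧ ¬ Shatters (Cclass n k) T := by
  classical
  set N := 32 * (k + 1) with hN
  obtain ⟨m, hmN, hmn, hm⟩ : ∃ m, m ≤ N ∧ m ≤ n / 2 ∧ N ≤ 2 ^ m := by
    rcases le_total N (n / 2) with hle | hle
    · exact ⟨N, le_rfl, hle, Nat.lt_two_pow_self.le⟩
    · exact ⟨n / 2, hle, le_rfl, h⟩
  obtain ⟨D, -, hD⟩ := Finset.exists_subset_card_eq
    (show 2 * m ≤ (Finset.univ : Finset (Fin n)).card by simp; omega)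
  have hN2 : N ^ 2 ≤ 2 ^ (2 * m) := by
    rw [mul_comm, pow_mul]
    exact Nat.pow_le_pow_left hm 2
  obtain ⟨T, hTD, hTcard⟩ := Finset.exists_subset_card_eq
    (show N ^ 2 ≤ (D.powerset.image cubePoint).card by
      rw [Finset.card_image_of_injective _ cubePoint_injective, Finset.card_powerset, hD]
      exact hN2)
  refine ⟨T, hTcard, fun hsh => ?_⟩
  have hT : ∀ x ∈ T, ∀ j ∉ D, x.1 j = 1 := fun x hx j hj => by
    obtain ⟨A, hA, rfl⟩ := Finset.mem_image.1 (hTD hx)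
    have hjA : j ∉ A := fun hjA => hj (Finset.mem_powerset.1 hA hjA)
    simp [cubePoint, hjA]
  have hcount := two_pow_card_le_of_shatters D T hT hsh
  rw [hTcard, hD] at hcount
  have hsucc : N ^ 2 + 1 ≤ 2 ^ (2 * m + 1) := by
    have := Nat.one_le_two_pow (n := 2 * m)
    rw [pow_succ 2 (2 * m)]
    omega
  have hexp : 2 ^ N ^ 2 ≤ 2 ^ ((2 * m + (2 * m + 1)) * k) :=
    calc 2 ^ N ^ 2 ≤ (2 ^ (2 * m)) ^ k * (N ^ 2 + 1) ^ k := hcount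
      _ ≤ (2 ^ (2 * m)) ^ k * (2 ^ (2 * m + 1)) ^ k := by gcongr
      _ = 2 ^ ((2 * m + (2 * m + 1)) * k) := by rw [← mul_pow, ← pow_add, ← pow_mul]
  have hle := (Nat.pow_le_pow_iff_right (by norm_num)).1 hexp
  have hbound : (2 * m + (2 * m + 1)) * k ≤ (4 * N + 1) * k :=
    Nat.mul_le_mul_right k (by omega)
  nlinarith
end

section
/- Let X be a finite set, p a probability measure on X, f : X → {−1,1} a target function, and C a class of functions from X to {−1,1} with VC dimension h satisfying 1 ≤ h ≤ ℓ. Draw x₁, …, x_ℓ independently with common distribution p. For g ∈ C define the risk R(g,f) = p({ x : g(x) ≠ f(x) }) and the empirical risk R_x(g,f) = (1/ℓ) · |{ i : g(x_i) ≠ f(x_i) }|. Then for every η ∈ (0,1), with probability at least 1 − η over the sample, simultaneously for all g ∈ C: R(g,f) ≤ R_x(g,f) + sqrt( ( h·(ln(2ℓ/h) + 1) − ln(η/4) ) / ℓ ). -/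
open Finset hiding Shatters

section Counting

/-- The sum of the first binomial coefficients is at most `(e N / h) ^ h`. -/
lemma sum_choose_Iic_le {h N : ℕ} (hh : 1 ≤ h) (hN : h ≤ N) :
    ((∑ k ∈ Iic h, N.choose k : ℕ) : ℝ) ≤ (Real.exp 1 * N / h) ^ h := by
  have h0 : (0 : ℝ) < h := by exact_mod_cast hh
  have N0 : (0 : ℝ) < N := by exact_mod_cast hh.trans hN
  have hle : (h : ℝ) / N ≤ 1 := (div_le_one N0).2 (by exact_mod_cast hN)
  have key : ((∑ k ∈ Iic h, N.choose k : ℕ) : ℝ) * ((h : ℝ) / N) ^ h ≤ Real.exp 1 ^ h := by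
    calc ((∑ k ∈ Iic h, N.choose k : ℕ) : ℝ) * ((h : ℝ) / N) ^ h
        = ∑ k ∈ Iic h, (N.choose k : ℝ) * ((h : ℝ) / N) ^ h := by
          push_cast
          rw [sum_mul]
      _ ≤ ∑ k ∈ Iic h, (N.choose k : ℝ) * ((h : ℝ) / N) ^ k := by
          refine sum_le_sum fun k hk => ?_
          gcongr ?_ * ?_
          exact pow_le_pow_of_le_one (by positivity) hle (mem_Iic.1 hk)
      _ ≤ ∑ k ∈ range (N + 1), (N.choose k : ℝ) * ((h : ℝ) / N) ^ k := by
          refine sum_le_sum_of_subset_of_nonneg (fun k hk => ?_) fun k _ _ => by positivity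
          have := mem_Iic.1 hk
          exact mem_range.2 (by omega)
      _ = ((h : ℝ) / N + 1) ^ N := by
          rw [add_pow]
          exact sum_congr rfl fun k _ => by simp [mul_comm]
      _ ≤ Real.exp ((h : ℝ) / N) ^ N := by
          gcongr
          exact Real.add_one_le_exp _
      _ = Real.exp 1 ^ h := by
          rw [← Real.exp_nat_mul, ← Real.exp_nat_mul]
          congr 1
          field_simp
  have hpos : (0 : ℝ) < ((h : ℝ) / N) ^ h := by positivity
  calc ((∑ k ∈ Iic h, N.choose k : ℕ) : ℝ) ≤ Real.exp 1 ^ h / ((h : ℝ) / N) ^ h :=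
        (le_div_iff₀ hpos).2 key
    _ = (Real.exp 1 * N / h) ^ h := by
        rw [← div_pow]
        congr 1
        field_simp

/-- The Sauer-Shelah bound for the error sets that a class of VC dimension at most `h`
induces on a finite sequence of points. -/
lemma card_errorTrace_le {X ι : Type*} [Fintype ι] [DecidableEq ι]
    {f : X → ℝ} (hf : ∀ x, f x = 1 ∨ f x = -1)
    {C : Set (X → ℝ)} (hC : ∀ g ∈ C, ∀ x, g x = 1 ∨ g x = -1) {h : ℕ}
    (hVC : ∀ T : Finset X, Shatters C T → T.card ≤ h) (z : ι → X) (𝒯 : Finset (Finset ι))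
    (h𝒯 : ∀ T ∈ 𝒯, ∃ g ∈ C, ∀ i, i ∈ T ↔ g (z i) ≠ f (z i)) :
    𝒯.card ≤ ∑ k ∈ Iic h, (Fintype.card ι).choose k := by
  classical
  have hdim : 𝒯.vcDim ≤ h := by
    refine Finset.sup_le fun s hs => ?_
    have hs' := mem_shatterer.1 hs
    have hinj : Set.InjOn z s := by
      intro i hi j hj hij
      obtain ⟨T, hT, hsT⟩ := hs'.exists_inter_eq_singleton hi
      obtain ⟨g, -, hg⟩ := h𝒯 T hT
      have hiT : i ∈ T := (mem_inter.1 (hsT ▸ mem_singleton_self i)).2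
      have hjT : j ∈ T := (hg j).2 (hij ▸ (hg i).1 hiT)
      exact (mem_singleton.1 (hsT ▸ mem_inter.2 ⟨hj, hjT⟩)).symm
    rw [← card_image_of_injOn hinj]
    refine hVC _ fun y hy => ?_
    obtain ⟨T, hT, hsT⟩ := hs' (filter_subset (fun i => y (z i) ≠ f (z i)) s)
    obtain ⟨g, hgC, hg⟩ := h𝒯 T hT
    refine ⟨g, hgC, fun x hx => ?_⟩
    obtain ⟨i, hi, rfl⟩ := mem_image.1 hx
    have hiff : g (z i) ≠ f (z i) ↔ y (z i) ≠ f (z i) := by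
      have := Finset.ext_iff.1 hsT i
      simp only [mem_inter, mem_filter, hi, true_and] at this
      rw [← hg i, this]
    have hyi := hy _ hx
    rcases hf (z i) with hfi | hfi <;> rcases hC g hgC (z i) with hgi | hgi <;>
      rcases hyi with hyi | hyi <;> rw [hgi, hyi] <;> rw [hgi, hyi, hfi] at hiff <;>
      norm_num at hiff
  calc 𝒯.card ≤ 𝒯.shatterer.card := card_le_card_shatterer _
    _ ≤ ∑ k ∈ Iic 𝒯.vcDim, (Fintype.card ι).choose k := card_shatterer_le_sum_vcDim
    _ ≤ _ := sum_le_sum_of_subset (Iic_subset_Iic.2 hdim)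

end Counting

section Symmetrization

/-- Hoeffding's lemma for the uniform distribution on a finite type. -/
lemma sum_exp_mean_sub_le {κ : Type*} [Fintype κ] [Nonempty κ] (b : κ → ℝ)
    (hb : ∀ a, b a ∈ Set.Icc (0 : ℝ) 1) (u : ℝ) :
    ∑ a, Real.exp (u * ((∑ j, b j) / Fintype.card κ - b a)) ≤
      Fintype.card κ * Real.exp (u ^ 2 / 8) := by
  let _ : MeasurableSpace κ := ⊤
  have hK : (0 : ℝ) < Fintype.card κ := by exact_mod_cast Fintype.card_pos
  have hint (F : κ → ℝ) : ∫ a, F a ∂(PMF.uniformOfFintype κ).toMeasure =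
      (∑ a, F a) / Fintype.card κ := by
    rw [PMF.integral_eq_sum]
    simp [← mul_sum, div_eq_inv_mul]
  have hsub := (ProbabilityTheory.hasSubgaussianMGF_of_mem_Icc
    (μ := (PMF.uniformOfFintype κ).toMeasure) (X := b) (a := 0) (b := 1)
    (measurable_of_finite b).aemeasurable (Filter.Eventually.of_forall hb)).mgf_le (-u)
  rw [ProbabilityTheory.mgf, hint, hint, div_le_iff₀ hK, mul_comm] at hsub
  refine (le_of_eq ?_).trans (hsub.trans (le_of_eq ?_))
  · exact sum_congr rfl fun a _ => by ring_nf
  · congr 2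
    simp
    ring

/-- Coefficients that single out one point in every block of `ι × κ`, giving it weight `-s`,
while the remaining points get weight `t`. -/
def splitCoeff {ι κ : Type*} [DecidableEq κ] (s t : ℝ) (σ : ι → κ) (q : ι × κ) : ℝ :=
  if q.2 = σ q.1 then -s else t

variable {ι κ : Type*} [Fintype ι] [DecidableEq ι] [Fintype κ] [DecidableEq κ]

/-- The exponential moment of the difference between ghost sample and sample when the sample
point is chosen uniformly in every block. -/
lemma sum_exp_splitCoeff_le [Nonempty κ] {s t : ℝ} (hst : s + t = t * Fintype.card κ)
    (b : ι × κ → ℝ) (hb : ∀ q, b q ∈ Set.Icc (0 : ℝ) 1) :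
    ∑ σ : ι → κ, Real.exp (∑ q, splitCoeff s t σ q * b q) ≤
      ((Fintype.card κ : ℝ) * Real.exp ((s + t) ^ 2 / 8)) ^ Fintype.card ι := by
  have hK : (Fintype.card κ : ℝ) ≠ 0 := by exact_mod_cast Fintype.card_ne_zero
  have hblock (i : ι) (a : κ) : ∑ j, (if j = a then -s else t) * b (i, j) =
      (s + t) * ((∑ j, b (i, j)) / Fintype.card κ - b (i, a)) := by
    have hsplit (j : κ) : (if j = a then -s else t) * b (i, j) =
        t * b (i, j) - (if j = a then (s + t) * b (i, j) else 0) := by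
      split_ifs <;> ring
    simp_rw [hsplit]
    rw [sum_sub_distrib, ← mul_sum, sum_ite_eq' univ a, if_pos (mem_univ a), mul_sub,
      mul_div_assoc', hst]
    field_simp
  calc ∑ σ : ι → κ, Real.exp (∑ q, splitCoeff s t σ q * b q)
      = ∑ σ : ι → κ, ∏ i,
          Real.exp ((s + t) * ((∑ j, b (i, j)) / Fintype.card κ - b (i, σ i))) := by
        refine sum_congr rfl fun σ _ => ?_
        rw [← Real.exp_sum, Fintype.sum_prod_type]
        simp only [splitCoeff, hblock]
    _ = ∏ i, ∑ a, Real.exp ((s + t) * ((∑ j, b (i, j)) / Fintype.card κ - b (i, a))) :=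
        (Fintype.prod_sum fun i a =>
          Real.exp ((s + t) * ((∑ j, b (i, j)) / Fintype.card κ - b (i, a)))).symm
    _ ≤ ∏ _i : ι, (Fintype.card κ : ℝ) * Real.exp ((s + t) ^ 2 / 8) :=
        prod_le_prod (fun i _ => sum_nonneg fun a _ => Real.exp_nonneg _) fun i _ =>
          sum_exp_mean_sub_le (fun j => b (i, j)) (fun j => hb _) _
    _ = _ := by rw [prod_const, card_univ]

variable {X : Type*} [Fintype X] [DecidableEq X]

/-- Symmetrization: conditionally on the sample `xs`, the exponential of the deviation from the
mean is at most its average over the ghost points. -/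
lemma prod_exp_le_sum_ghost {p : X → ℝ} (hp0 : ∀ x, 0 ≤ p x) (hp1 : ∑ x, p x = 1)
    {s t : ℝ} (hst : s + t = t * Fintype.card κ) (σ : ι → κ) (xs : ι → X) (b : X → ℝ) :
    (∏ i, p (xs i)) * Real.exp (s * ∑ i, (∑ x, p x * b x - b (xs i))) ≤
      ∑ z : ι × κ → X, if (fun i => z (i, σ i)) = xs then
        (∏ q, p (z q)) * Real.exp (∑ q, splitCoeff s t σ q * b (z q)) else 0 := by
  set m := ∑ x, p x * b x with hm
  let φ (q : ι × κ) (x : X) : ℝ :=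
    if q.2 = σ q.1 then (if x = xs q.1 then p x * Real.exp (-s * b x) else 0)
    else p x * Real.exp (t * b x)
  have hfactor (z : ι × κ → X) : (if (fun i => z (i, σ i)) = xs then
      (∏ q, p (z q)) * Real.exp (∑ q, splitCoeff s t σ q * b (z q)) else 0) =
      ∏ q, φ q (z q) := by
    split_ifs with hz
    · rw [Real.exp_sum, ← prod_mul_distrib]
      refine prod_congr rfl fun q _ => ?_
      rcases q with ⟨i, j⟩
      by_cases hj : j = σ i
      · subst hj
        simp [φ, splitCoeff, ← hz]
      · simp [φ, splitCoeff, hj]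
    · obtain ⟨i, hi⟩ := Function.ne_iff.1 hz
      exact (prod_eq_zero (mem_univ (i, σ i)) (by simp [φ, hi])).symm
  have hjensen : Real.exp (t * m) ≤ ∑ x, p x * Real.exp (t * b x) := by
    have := convexOn_exp.map_sum_le (t := univ) (w := p) (p := fun x => t * b x)
      (fun x _ => hp0 x) hp1 fun _ _ => Set.mem_univ _
    simp only [smul_eq_mul] at this
    rwa [show ∑ x, p x * (t * b x) = t * m by
      rw [hm, mul_sum]; exact sum_congr rfl fun x _ => by ring] at this
  have hcard (i : ι) : ((univ.erase (σ i)).card : ℝ) * t = s := by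
    have : ((univ.erase (σ i)).card : ℝ) + 1 = Fintype.card κ := by
      exact_mod_cast card_erase_add_one (mem_univ (σ i))
    linear_combination t * this - hst
  have hblock (i : ι) : p (xs i) * Real.exp (s * (m - b (xs i))) ≤ ∏ j, ∑ x, φ (i, j) x := by
    have hpt : ∑ x, φ (i, σ i) x = p (xs i) * Real.exp (-s * b (xs i)) := by simp [φ]
    rw [← mul_prod_erase univ _ (mem_univ (σ i)), hpt,
      show s * (m - b (xs i)) = -s * b (xs i) + s * m by ring, Real.exp_add, ← mul_assoc]
    refine mul_le_mul_of_nonneg_left ?_ (mul_nonneg (hp0 _) (Real.exp_nonneg _))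
    calc Real.exp (s * m) = ∏ _j ∈ univ.erase (σ i), Real.exp (t * m) := by
          rw [prod_const, ← Real.exp_nat_mul, ← mul_assoc, hcard]
      _ ≤ _ := by
          refine prod_le_prod (fun _ _ => Real.exp_nonneg _) fun j hj => ?_
          simpa [φ, (mem_erase.1 hj).1] using hjensen
  simp_rw [hfactor]
  rw [← Fintype.prod_sum, Fintype.prod_prod_type, mul_sum, Real.exp_sum, ← prod_mul_distrib]
  exact prod_le_prod (fun i _ => mul_nonneg (hp0 _) (Real.exp_nonneg _)) fun i _ => hblock i

/-- The probability that the deviation of some member of `𝒜` exceeds `ε`, bounded by the number of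
traces of `𝒜` on a sample enlarged by ghost points. -/
lemma sum_prod_deviation_le [Nonempty κ] {p : X → ℝ} (hp0 : ∀ x, 0 ≤ p x) (hp1 : ∑ x, p x = 1)
    {s t : ℝ} (hs : 0 ≤ s) (hst : s + t = t * Fintype.card κ) (𝒜 : Finset (Finset X)) {M : ℝ}
    (hM : ∀ z : ι × κ → X, ((𝒜.image fun A => univ.filter fun q => z q ∈ A).card : ℝ) ≤ M)
    (ε : ℝ) (B : Finset (ι → X))
    (hB : ∀ xs ∈ B, ∃ A ∈ 𝒜, ε * Fintype.card ι ≤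
      ∑ i, (∑ x, p x * (if x ∈ A then 1 else 0) - if xs i ∈ A then 1 else 0)) :
    ∑ xs ∈ B, ∏ i, p (xs i) ≤
      M * Real.exp (Fintype.card ι * ((s + t) ^ 2 / 8 - s * ε)) := by
  set n := Fintype.card ι with hn
  let 𝒯 (z : ι × κ → X) := 𝒜.image fun A => univ.filter fun q => z q ∈ A
  let G (σ : ι → κ) (T : Finset (ι × κ)) : ℝ :=
    Real.exp (∑ q, splitCoeff s t σ q * if q ∈ T then 1 else 0)
  have hw (z : ι × κ → X) : 0 ≤ ∏ q, p (z q) := prod_nonneg fun q _ => hp0 _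
  have hpoint (σ : ι → κ) (xs : ι → X) (hxs : xs ∈ B) :
      (∏ i, p (xs i)) * Real.exp (s * (ε * n)) ≤
        ∑ z : ι × κ → X, if (fun i => z (i, σ i)) = xs then
          (∏ q, p (z q)) * ∑ T ∈ 𝒯 z, G σ T else 0 := by
    obtain ⟨A, hA, hdev⟩ := hB xs hxs
    calc _ ≤ (∏ i, p (xs i)) * Real.exp (s *
          ∑ i, (∑ x, p x * (if x ∈ A then 1 else 0) - if xs i ∈ A then 1 else 0)) := by
          gcongr
          exact prod_nonneg fun i _ => hp0 _
      _ ≤ _ := prod_exp_le_sum_ghost hp0 hp1 hst σ xs fun x => if x ∈ A then 1 else 0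
      _ ≤ _ := by
          refine sum_le_sum fun z _ => ?_
          split_ifs
          · refine mul_le_mul_of_nonneg_left ?_ (hw z)
            have hmem : (univ.filter fun q => z q ∈ A) ∈ 𝒯 z := mem_image_of_mem _ hA
            refine le_trans (le_of_eq ?_)
              (single_le_sum (f := G σ) (fun T _ => Real.exp_nonneg _) hmem)
            simp only [G, mem_filter, mem_univ, true_and]
          · exact le_rfl
  have hsigma (σ : ι → κ) : (∑ xs ∈ B, ∏ i, p (xs i)) * Real.exp (s * (ε * n)) ≤
      ∑ z : ι × κ → X, (∏ q, p (z q)) * ∑ T ∈ 𝒯 z, G σ T := by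
    rw [sum_mul]
    refine (sum_le_sum (hpoint σ)).trans ?_
    rw [sum_comm]
    refine sum_le_sum fun z _ => ?_
    rw [sum_ite_eq]
    split_ifs
    · exact le_rfl
    · exact mul_nonneg (hw z) (sum_nonneg fun T _ => Real.exp_nonneg _)
  have htotal : ∑ z : ι × κ → X, ∏ q, p (z q) = 1 := by
    rw [← Fintype.prod_sum fun (_ : ι × κ) x => p x]
    simp [hp1]
  have hK : (0 : ℝ) < Fintype.card κ := by exact_mod_cast Fintype.card_pos
  set D := ((Fintype.card κ : ℝ) * Real.exp ((s + t) ^ 2 / 8)) ^ n with hD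
  have hD0 : 0 ≤ D := by positivity
  have havg : (Fintype.card κ : ℝ) ^ n *
      ((∑ xs ∈ B, ∏ i, p (xs i)) * Real.exp (s * (ε * n))) ≤ M * D := by
    calc _ = ∑ _σ : ι → κ, (∑ xs ∈ B, ∏ i, p (xs i)) * Real.exp (s * (ε * n)) := by
          simp [hn]
      _ ≤ ∑ σ : ι → κ, ∑ z : ι × κ → X, (∏ q, p (z q)) * ∑ T ∈ 𝒯 z, G σ T :=
          sum_le_sum fun σ _ => hsigma σ
      _ = ∑ z : ι × κ → X, (∏ q, p (z q)) * ∑ T ∈ 𝒯 z, ∑ σ : ι → κ, G σ T := by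
          rw [sum_comm]
          refine sum_congr rfl fun z _ => ?_
          rw [← mul_sum, sum_comm]
      _ ≤ ∑ z : ι × κ → X, (∏ q, p (z q)) * (M * D) := by
          refine sum_le_sum fun z _ => mul_le_mul_of_nonneg_left ?_ (hw z)
          calc _ ≤ ∑ _T ∈ 𝒯 z, D := sum_le_sum fun T _ =>
                sum_exp_splitCoeff_le hst _ fun q => by split_ifs <;> simp
            _ = (𝒯 z).card * D := by simp
            _ ≤ M * D := mul_le_mul_of_nonneg_right (hM z) hD0
      _ = M * D := by rw [← sum_mul, htotal, one_mul]
  rw [hD, mul_pow, mul_left_comm M] at havg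
  have h1 := le_of_mul_le_mul_left havg (by positivity)
  rw [← le_div_iff₀ (Real.exp_pos _), mul_div_assoc, ← Real.exp_nat_mul, ← Real.exp_sub] at h1
  refine h1.trans (le_of_eq ?_)
  congr 2
  ring

end Symmetrization

/-- If `log (2 r) + 1 < r` with `r ≥ 1`, then `log (2 r) + 1 ≥ 2.64`. -/
lemma le_log_two_mul_add_one {r : ℝ} (hr : 1 ≤ r) (hlt : Real.log (2 * r) + 1 < r) :
    (2.64 : ℝ) ≤ Real.log (2 * r) + 1 := by
  have h52 : (1.64 : ℝ) ≤ Real.log 5.2 := by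
    rw [Real.le_log_iff_exp_le (by norm_num)]
    have h1 : Real.exp 1.64 ^ 25 ≤ (5.2 : ℝ) ^ 25 := by
      rw [← Real.exp_nat_mul, show ((25 : ℕ) : ℝ) * 1.64 = (41 : ℕ) * 1 by norm_num,
        Real.exp_nat_mul]
      calc Real.exp 1 ^ 41 ≤ (2.7182818286 : ℝ) ^ 41 := by
            gcongr
            exact Real.exp_one_lt_d9.le
        _ ≤ _ := by norm_num
    exact le_of_pow_le_pow_left₀ (by norm_num) (by norm_num) h1
  have hr26 : 2.6 ≤ r := by
    by_contra! hcon
    have ha : 0 ≤ (2.6 - r) / 1.6 := div_nonneg (by linarith) (by norm_num)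
    have hb : 0 ≤ (r - 1) / 1.6 := div_nonneg (by linarith) (by norm_num)
    have hconc := strictConcaveOn_log_Ioi.concaveOn.2 (show (2 : ℝ) ∈ Set.Ioi 0 by norm_num)
      (show (5.2 : ℝ) ∈ Set.Ioi 0 by norm_num) ha hb (by ring)
    have harg : (2.6 - r) / 1.6 * 2 + (r - 1) / 1.6 * 5.2 = 2 * r := by ring
    simp only [smul_eq_mul] at hconc
    rw [harg] at hconc
    have h2 := Real.log_two_gt_d9
    nlinarith [mul_le_mul_of_nonneg_left h52 hb, mul_le_mul_of_nonneg_left h2.le ha]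
  have := Real.log_le_log (by norm_num) (show (5.2 : ℝ) ≤ 2 * r by linarith)
  linarith

/-- Vapnik's bound: if `C` has VC dimension `h` with `1 ≤ h ≤ ℓ`, then with probability at
least `1 - η` over an i.i.d. sample `x₁, …, x_ℓ` drawn from `p`, simultaneously for all
`g ∈ C` the risk `R(g,f)` is at most the empirical risk `R_x(g,f)` plus
`√((h (ln (2ℓ/h) + 1) - ln (η/4)) / ℓ)`.  The probability of the event is expressed as the
sum over all samples `xs : Fin ℓ → X` of the product `∏ i, p (xs i)` restricted to the
event. -/
theorem vapnik_risk_bound {X : Type*} [Fintype X]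
    (p : X → ℝ) (hp0 : ∀ x, 0 ≤ p x) (hp1 : ∑ x, p x = 1)
    (f : X → ℝ) (hf : ∀ x, f x = 1 ∨ f x = -1)
    (C : Set (X → ℝ)) (hC : ∀ g ∈ C, ∀ x, g x = 1 ∨ g x = -1)
    (h ℓ : ℕ) (hh : 1 ≤ h) (hℓ : h ≤ ℓ)
    (hVCub : ∀ T : Finset X, Shatters C T → T.card ≤ h)
    (hVClb : ∃ T : Finset X, Shatters C T ∧ T.card = h)
    (η : ℝ) (hη0 : 0 < η) (hη1 : η < 1) :
    1 - η ≤ ∑ xs : Fin ℓ → X,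
      Set.indicator
        {xs : Fin ℓ → X | ∀ g ∈ C,
          (∑ x ∈ Finset.univ.filter fun x => g x ≠ f x, p x) ≤
            ((Finset.univ.filter fun i : Fin ℓ => g (xs i) ≠ f (xs i)).card : ℝ) / ℓ +
              Real.sqrt ((h * (Real.log (2 * ℓ / h) + 1) - Real.log (η / 4)) / ℓ)}
        (fun xs => ∏ i, p (xs i)) xs := by
  classical
  have h0 : (0 : ℝ) < h := by exact_mod_cast hh
  have hhℓ : (h : ℝ) ≤ ℓ := by exact_mod_cast hℓ
  have ℓ0 : (0 : ℝ) < ℓ := h0.trans_le hhℓ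
  set L := Real.log (2 * ℓ / h) + 1 with hL
  set Q := h * L - Real.log (η / 4) with hQ
  set ε := Real.sqrt (Q / ℓ) with hε
  set good := {xs : Fin ℓ → X | ∀ g ∈ C,
    (∑ x ∈ Finset.univ.filter fun x => g x ≠ f x, p x) ≤
      ((Finset.univ.filter fun i : Fin ℓ => g (xs i) ≠ f (xs i)).card : ℝ) / ℓ + ε} with hgood
  have htotal : ∑ xs : Fin ℓ → X, ∏ i, p (xs i) = 1 := by
    rw [← Fintype.prod_sum fun (_ : Fin ℓ) x => p x]
    simp [hp1]
  have hlogη : Real.log (η / 4) = Real.log η - Real.log 4 :=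
    Real.log_div hη0.ne' (by norm_num)
  have hlogη0 : Real.log η < 0 := Real.log_neg hη0 hη1
  have hlog4 : Real.log 4 = 2 * Real.log 2 := by
    rw [show (4 : ℝ) = 2 ^ 2 by norm_num, Real.log_pow]
    norm_num
  have hlog2 := Real.log_two_gt_d9
  have hlog2' := Real.log_two_lt_d9
  rcases le_or_gt 1 ε with hε1 | hε1
  · have hall : ∀ xs, xs ∈ good := fun xs g _ => by
      have hle : (∑ x ∈ Finset.univ.filter fun x => g x ≠ f x, p x) ≤ 1 :=
        hp1 ▸ sum_le_sum_of_subset_of_nonneg (filter_subset _ _) fun x _ _ => hp0 x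
      have : (0 : ℝ) ≤ ((Finset.univ.filter fun i : Fin ℓ => g (xs i) ≠ f (xs i)).card : ℝ) / ℓ :=
        by positivity
      linarith
    simp only [Set.indicator_of_mem (hall _), htotal]
    linarith
  have hr1 : 1 ≤ (ℓ : ℝ) / h := (one_le_div h0).2 hhℓ
  have hr : (2 : ℝ) * ℓ / h = 2 * (ℓ / h) := by ring
  have hQℓ : Q < ℓ := by
    have : Q / ℓ < 1 := by
      by_contra! hcon
      exact absurd (Real.one_le_sqrt.2 hcon) (not_le.2 hε1)
    rwa [div_lt_one ℓ0] at this
  have hL264 : 2.64 ≤ L := by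
    rw [hL, hr]
    refine le_log_two_mul_add_one hr1 ?_
    rw [← hr, ← hL, lt_div_iff₀ h0]
    linarith
  have hQ0 : 0 ≤ Q := by nlinarith
  have hεsq : ℓ * ε ^ 2 = Q := by
    rw [hε, Real.sq_sqrt (by positivity)]
    field_simp
  have hε0 : 0 ≤ ε := Real.sqrt_nonneg _
  let err (g : X → ℝ) : Finset X := univ.filter fun x => g x ≠ f x
  let 𝒜 : Finset (Finset X) := univ.filter fun A => ∃ g ∈ C, err g = A
  have hcard (z : Fin ℓ × Fin 8 → X) :
      ((𝒜.image fun A => univ.filter fun q => z q ∈ A).card : ℝ) ≤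
        (Real.exp 1 * (ℓ * 8 : ℕ) / h) ^ h := by
    refine le_trans ?_ (sum_choose_Iic_le hh (by omega))
    have := card_errorTrace_le hf hC hVCub z
      (𝒜.image fun A => univ.filter fun q => z q ∈ A) fun T hT => by
        obtain ⟨A, hA, rfl⟩ := mem_image.1 hT
        obtain ⟨g, hg, rfl⟩ := (mem_filter.1 hA).2
        exact ⟨g, hg, fun i => by simp [err]⟩
    rw [Fintype.card_prod, Fintype.card_fin, Fintype.card_fin] at this
    exact_mod_cast this
  have hbad := sum_prod_deviation_le (ι := Fin ℓ) (κ := Fin 8) hp0 hp1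
    (s := 49 / 16 * ε) (t := 7 / 16 * ε) (by positivity) (by simp; ring) 𝒜 hcard ε
    (univ.filter fun xs => xs ∉ good) fun xs hxs => by
      have hxs' := (mem_filter.1 hxs).2
      simp only [hgood, Set.mem_ofPred_eq, not_forall, not_le] at hxs'
      obtain ⟨g, hg, hlt⟩ := hxs'
      refine ⟨err g, mem_filter.2 ⟨mem_univ _, g, hg, rfl⟩, ?_⟩
      rw [sum_sub_distrib, sum_boole]
      simp only [err, mem_filter, mem_univ, true_and, mul_ite, mul_one, mul_zero, ← sum_filter,
        sum_const, card_univ, Fintype.card_fin, nsmul_eq_mul]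
      have := mul_lt_mul_of_pos_left hlt ℓ0
      rw [mul_add, mul_div_cancel₀ _ ℓ0.ne'] at this
      linarith
  have hbound : (Real.exp 1 * (ℓ * 8 : ℕ) / h) ^ h * Real.exp (Fintype.card (Fin ℓ) *
      ((49 / 16 * ε + 7 / 16 * ε) ^ 2 / 8 - 49 / 16 * ε * ε)) ≤ η := by
    have hbase : Real.exp 1 * ((ℓ * 8 : ℕ) : ℝ) / h = Real.exp (L + 2 * Real.log 2) := by
      rw [← hlog4, hL, Real.exp_add, Real.exp_add, Real.exp_log (by positivity),
        Real.exp_log (by norm_num)]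
      push_cast
      ring
    have hexp : (ℓ : ℝ) * ((49 / 16 * ε + 7 / 16 * ε) ^ 2 / 8 - 49 / 16 * ε * ε) =
        -(49 / 32) * Q := by
      rw [← hεsq]
      ring
    rw [Fintype.card_fin, hbase, hexp, ← Real.exp_nat_mul, ← Real.exp_add,
      ← Real.le_log_iff_exp_le hη0]
    nlinarith
  have hsplit : ∑ xs : Fin ℓ → X, good.indicator (fun xs => ∏ i, p (xs i)) xs +
      ∑ xs ∈ univ.filter (fun xs => xs ∉ good), ∏ i, p (xs i) = 1 := by
    simp only [Set.indicator_apply]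
    rw [← htotal, ← sum_filter, sum_filter_add_sum_filter_not]
  linarith
end

section
/- For all positive integers N and k with 1 ≤ k ≤ N, one has binomial(N, k) · 2 · ( ∑_{j=0}^{k−1} binomial(N − 1, j) ) ≤ binomial(2N, k)². -/
/-- Pascal's rule summed over an initial segment of a row. -/
theorem sum_range_succ_choose_succ (n k : ℕ) :
    ∑ j ∈ Finset.range (k + 1), (n + 1).choose j =
      2 * ∑ j ∈ Finset.range k, n.choose j + n.choose k := by
  induction k with
  | zero => simp
  | succ k ih =>
    rw [Finset.sum_range_succ, ih, Finset.sum_range_succ, Nat.choose_succ_succ']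
    ring

/-- Each term of Vandermonde's sum for `(2 * n).choose k` dominates `n.choose j`. -/
theorem sum_range_succ_choose_le_choose_two_mul {n k : ℕ} (hkn : k ≤ n) :
    ∑ j ∈ Finset.range (k + 1), n.choose j ≤ (2 * n).choose k := by
  rw [two_mul, Nat.add_choose_eq, Finset.Nat.sum_antidiagonal_eq_sum_range_succ
    (fun i j => n.choose i * n.choose j)]
  refine Finset.sum_le_sum fun j _ => Nat.le_mul_of_pos_right _ (Nat.choose_pos ?_)
  omega

/-- For `1 ≤ k ≤ N`:
`(N choose k) · 2 · ∑_{j=0}^{k-1} ((N-1) choose j) ≤ ((2N) choose k)²`. -/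
theorem choose_mul_partial_sum_le_sq (N k : ℕ) (hk : 1 ≤ k) (hkN : k ≤ N) :
    Nat.choose N k * 2 * (∑ j ∈ Finset.range k, Nat.choose (N - 1) j) ≤
      Nat.choose (2 * N) k ^ 2 := by
  have hsum := sum_range_succ_choose_le_choose_two_mul hkN
  obtain ⟨n, rfl⟩ : ∃ n, N = n + 1 := ⟨N - 1, by omega⟩
  rw [sum_range_succ_choose_succ] at hsum
  rw [Nat.add_sub_cancel, sq, mul_assoc]
  exact Nat.mul_le_mul (Nat.choose_le_choose k (by omega)) (by omega)
end
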